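/- Let s ≥ 4 be an integer and let W = {(x,0) : 1 ≤ x ≤ s²} ∪ {(l·s,1) : 1 ≤ l ≤ s} ⊆ ℤ². Then for every q ∈ ℤ²∖{(0,0)}, the set (q + W)∖W has cardinality strictly greater than s. -/

import Mathlib

/-- A site of the two-dimensional lattice. -/
abbrev Site : Type := ℤ × ℤ

/-- The set `W = {(x,0) : 1 ≤ x ≤ s²} ∪ {(l·s,1) : 1 ≤ l ≤ s}`. -/
def Wset (s : ℕ) : Finset Site :=
  (Finset.Icc 1 (s ^ 2)).image (fun x : ℕ => ((x : ℤ), (0 : ℤ))) ∪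
    (Finset.Icc 1 s).image (fun l : ℕ => (((l * s : ℕ) : ℤ), (1 : ℤ)))

theorem mem_Wset {s : ℕ} {x y : ℤ} :
    (x, y) ∈ Wset s ↔ (y = 0 ∧ 1 ≤ x ∧ x ≤ (s : ℤ) ^ 2) ∨
      (y = 1 ∧ ∃ l : ℤ, 1 ≤ l ∧ l ≤ s ∧ x = l * s) := by
  simp only [Wset, Finset.mem_union, Finset.mem_image, Finset.mem_Icc, Prod.mk.injEq]
  constructor
  · rintro (⟨n, ⟨h1, h2⟩, rfl, rfl⟩ | ⟨l, ⟨h1, h2⟩, rfl, rfl⟩)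
    · exact Or.inl ⟨rfl, by exact_mod_cast h1, by exact_mod_cast h2⟩
    · exact Or.inr ⟨rfl, l, by exact_mod_cast h1, by exact_mod_cast h2, by push_cast; rfl⟩
  · rintro (⟨rfl, h1, h2⟩ | ⟨rfl, l, h1, h2, rfl⟩)
    · lift x to ℕ using by omega
      exact Or.inl ⟨x, ⟨by exact_mod_cast h1, by exact_mod_cast h2⟩, rfl, rfl⟩
    · lift l to ℕ using by omega
      exact Or.inr ⟨l, ⟨by exact_mod_cast h1, by exact_mod_cast h2⟩, by push_cast; rfl, rfl⟩

/-- `s` points of `W` leaving `W` under translation, indexed injectively, together with one more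
such point, give more than `s` points of `(q + W) \ W`. -/
theorem lt_card_translate_sdiff {W : Finset Site} {s : ℕ} {q : Site} (f : ℕ → Site) (p : Site)
    (hinj : Function.Injective f)
    (hf : ∀ l : ℕ, 1 ≤ l → l ≤ s → f l ∈ W ∧ q + f l ∉ W ∧ f l ≠ p)
    (hp : p ∈ W) (hqp : q + p ∉ W) :
    s < (W.image (fun w => q + w) \ W).card := by
  have hnot : p ∉ (Finset.Icc 1 s).image f := by
    simp only [Finset.mem_image, Finset.mem_Icc, not_exists, not_and]
    exact fun l hl => (hf l hl.1 hl.2).2.2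
  have hsub : (insert p ((Finset.Icc 1 s).image f)).image (fun w => q + w) ⊆
      W.image (fun w => q + w) \ W := by
    intro z hz
    obtain ⟨w, hw, rfl⟩ := Finset.mem_image.1 hz
    rw [Finset.mem_sdiff]
    rcases Finset.mem_insert.1 hw with rfl | hw
    · exact ⟨Finset.mem_image_of_mem _ hp, hqp⟩
    · obtain ⟨l, hl, rfl⟩ := Finset.mem_image.1 hw
      have h := hf l (Finset.mem_Icc.1 hl).1 (Finset.mem_Icc.1 hl).2
      exact ⟨Finset.mem_image_of_mem _ h.1, h.2.1⟩
  have hcard := Finset.card_le_card hsub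
  rw [Finset.card_image_of_injective _ (add_right_injective q), Finset.card_insert_of_notMem hnot,
    Finset.card_image_of_injective _ hinj, Nat.card_Icc] at hcard
  omega

/-- for `s ≥ 4` and any nonzero `q ∈ ℤ²`, the translate `q + W`
differs from `W` in strictly more than `s` points: `|(q + W) ∖ W| > s`. -/
theorem translate_W_diff (s : ℕ) (hs : 4 ≤ s) (q : Site) (hq : q ≠ (0, 0)) :
    s < ((Wset s).image (fun w => q + w) \ Wset s).card := by
  obtain ⟨a, b⟩ := q
  have hs' : (4 : ℤ) ≤ s := by exact_mod_cast hs
  have hsq : (s : ℤ) * 4 ≤ (s : ℤ) ^ 2 := by nlinarith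
  have row_zero (c : ℤ) : Function.Injective fun l : ℕ => ((c + l, 0) : Site) := by
    intro i j h
    simpa using h
  have row_one : Function.Injective fun l : ℕ => ((l * s, 1) : Site) := by
    intro i j h
    simpa [show s ≠ 0 by omega] using h
  have row_one_mem (l : ℕ) (h1 : 1 ≤ l) (h2 : l ≤ s) : ((l * s, 1) : Site) ∈ Wset s :=
    mem_Wset.2 (Or.inr ⟨rfl, l, by exact_mod_cast h1, by exact_mod_cast h2, rfl⟩)
  by_cases hb0 : b = 0
  · subst hb0
    have ha : a ≠ 0 := by
      rintro rfl
      exact hq rfl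
    by_cases hdvd : (s : ℤ) ∣ a
    · rcases lt_or_gt_of_ne ha with hneg | hpos
      · have hle : (s : ℤ) ≤ -a := Int.le_of_dvd (by omega) ((dvd_neg).2 hdvd)
        refine lt_card_translate_sdiff (fun l => (0 + l, 0)) (s, 1) (row_zero 0) ?_ ?_ ?_
        · intro l h1 h2
          refine ⟨mem_Wset.2 (Or.inl ⟨rfl, by omega, by omega⟩), ?_, by simp⟩
          rw [Prod.mk_add_mk, mem_Wset]
          omega
        · exact mem_Wset.2 (Or.inr ⟨rfl, 1, le_rfl, by omega, by ring⟩)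
        · rw [Prod.mk_add_mk, mem_Wset]
          rintro (⟨h, -⟩ | ⟨-, l, h1, h2, h3⟩)
          · omega
          · nlinarith
      · have hle : (s : ℤ) ≤ a := Int.le_of_dvd hpos hdvd
        refine lt_card_translate_sdiff (fun l => ((s : ℤ) ^ 2 - s + l, 0)) (s * s, 1)
          (row_zero _) ?_ (row_one_mem s (by omega) le_rfl) ?_
        · intro l h1 h2
          refine ⟨mem_Wset.2 (Or.inl ⟨rfl, by omega, by omega⟩), ?_, by simp⟩
          rw [Prod.mk_add_mk, mem_Wset]
          omega
        · rw [Prod.mk_add_mk, mem_Wset]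
          rintro (⟨h, -⟩ | ⟨-, l, h1, h2, h3⟩)
          · omega
          · nlinarith
    · refine lt_card_translate_sdiff (fun l => (l * s, 1)) (if 0 < a then (s : ℤ) ^ 2 else 1, 0)
        row_one ?_ ?_ ?_
      · intro l h1 h2
        refine ⟨row_one_mem l h1 h2, ?_, by simp⟩
        rw [Prod.mk_add_mk, mem_Wset]
        rintro (⟨h, -⟩ | ⟨-, m, -, -, h⟩)
        · omega
        · exact hdvd ⟨m - l, by linear_combination h⟩
      · rw [mem_Wset]
        split_ifs <;> omega
      · rw [Prod.mk_add_mk, mem_Wset]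
        split_ifs <;> omega
  · by_cases hb1 : b = 1
    · subst hb1
      obtain ⟨c, hc1, hc2, hc⟩ : ∃ c : ℤ, 1 ≤ c ∧ c ≤ 2 ∧ ¬ (s : ℤ) ∣ a + c := by
        by_cases h : (s : ℤ) ∣ a + 1
        · refine ⟨2, by omega, le_rfl, fun h2 => ?_⟩
          have h3 : (s : ℤ) ∣ 1 := by simpa using dvd_sub h2 h
          have := Int.le_of_dvd one_pos h3
          omega
        · exact ⟨1, le_rfl, by omega, h⟩
      refine lt_card_translate_sdiff (fun l => (l * s, 1)) (c, 0) row_one ?_ ?_ ?_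
      · intro l h1 h2
        refine ⟨row_one_mem l h1 h2, ?_, by simp⟩
        rw [Prod.mk_add_mk, mem_Wset]
        omega
      · exact mem_Wset.2 (Or.inl ⟨rfl, by omega, by omega⟩)
      · rw [Prod.mk_add_mk, mem_Wset]
        rintro (⟨h, -⟩ | ⟨-, l, -, -, h⟩)
        · omega
        · exact hc ⟨l, by linear_combination h⟩
    · refine lt_card_translate_sdiff (fun l => (0 + l, 0)) (s + 1, 0) (row_zero 0) ?_ ?_ ?_
      · intro l h1 h2
        refine ⟨mem_Wset.2 (Or.inl ⟨rfl, by omega, by omega⟩), ?_, ?_⟩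
        · rw [Prod.mk_add_mk, mem_Wset]
          omega
        · rw [Ne, Prod.mk.injEq]
          omega
      · exact mem_Wset.2 (Or.inl ⟨rfl, by omega, by omega⟩)
      · rw [Prod.mk_add_mk, mem_Wset]
        omega
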